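/- Let G be a bipartite graph with parts V_1, V_2, each of size n, and 3k − 1 ≤ n. Construct the bipartite graph G' with parts V_1' = V_1 ∪ {a} and V_2' = V_2 ∪ W ∪ {b} where |W| = n − 3k + 1, and edges: (u,v) for u ∈ V_1, v ∈ V_2 with (u,v) ∉ E(G); (a,v) for every v ∈ V_2'; and (b,u) for every u ∈ V_1'. Then G contains a complete bipartite subgraph K_{k,k} (with k vertices in each part) if and only if G' admits a proper 3-coloring in which every color class has size exactly n − k + 1. -/

import Mathlib

open Finset

/-- The cross edges of the graph `G'`: between `V₁' = V₁ ∪ {a}` (left) and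
`V₂' = V₂ ∪ W ∪ {b}` (right).  `E` is the adjacency of the original bipartite
graph `G` between `V₁` and `V₂`. -/
def cross6 (n k : ℕ) (E : Fin n → Fin n → Prop) :
    (Fin n ⊕ Unit) → (Fin n ⊕ (Fin (n + 1 - 3 * k) ⊕ Unit)) → Prop
  | Sum.inl u, Sum.inl v => ¬ E u v        -- non-edges of G
  | Sum.inl _, Sum.inr (Sum.inl _) => False -- V₁ to W : no edge
  | Sum.inl _, Sum.inr (Sum.inr _) => True  -- b adjacent to all of V₁'
  | Sum.inr _, _ => True                    -- a adjacent to all of V₂'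

/-- The bipartite graph `G'` of the reduction. -/
def G6 (n k : ℕ) (E : Fin n → Fin n → Prop) :
    SimpleGraph ((Fin n ⊕ Unit) ⊕ (Fin n ⊕ (Fin (n + 1 - 3 * k) ⊕ Unit))) :=
  SimpleGraph.fromRel
    (fun x y => ∃ l r, x = Sum.inl l ∧ y = Sum.inr r ∧ cross6 n k E l r)

theorem cardSplit6 (n m : ℕ) (φ : (Fin n ⊕ Unit) ⊕ (Fin n ⊕ (Fin m ⊕ Unit)) → Fin 3) (i : Fin 3) :
    (univ.filter fun x => φ x = i).card =
      ((univ.filter fun u => φ (Sum.inl (Sum.inl u)) = i).card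
        + (if φ (Sum.inl (Sum.inr ())) = i then 1 else 0))
      + ((univ.filter fun v => φ (Sum.inr (Sum.inl v)) = i).card
        + ((univ.filter fun w => φ (Sum.inr (Sum.inr (Sum.inl w))) = i).card
        + (if φ (Sum.inr (Sum.inr (Sum.inr ()))) = i then 1 else 0))) := by
  simp only [Finset.card_filter, Fintype.sum_sum_type, Finset.univ_unique, Finset.sum_singleton]

theorem third6 : ∀ α β : Fin 3, α ≠ β → ∃ γ : Fin 3, γ ≠ α ∧ γ ≠ β ∧
    ∀ x : Fin 3, x = α ∨ x = β ∨ x = γ := by decide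

theorem stmt6 (n k : ℕ) (hk : 3 * k - 1 ≤ n) (E : Fin n → Fin n → Prop) :
    (∃ A B : Finset (Fin n), A.card = k ∧ B.card = k ∧
        ∀ a ∈ A, ∀ b ∈ B, E a b) ↔
    (∃ φ : (Fin n ⊕ Unit) ⊕ (Fin n ⊕ (Fin (n + 1 - 3 * k) ⊕ Unit)) → Fin 3,
      (∀ x y, (G6 n k E).Adj x y → φ x ≠ φ y) ∧
      ∀ i : Fin 3, (univ.filter fun x => φ x = i).card = n - k + 1) := by
  have hkn : k ≤ n := by omega
  constructor
  · rintro ⟨A, B, hA, hB, hE⟩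
    refine ⟨Sum.elim (Sum.elim (fun u => if u ∈ A then 2 else 0) (fun _ => 0))
      (Sum.elim (fun v => if v ∈ B then 2 else 1) (Sum.elim (fun _ => 2) (fun _ => 1))), ?_, ?_⟩
    · have key : ∀ l r, cross6 n k E l r →
          (Sum.elim (fun u => if u ∈ A then 2 else 0) (fun _ => 0) l : Fin 3) ≠
          (Sum.elim (fun v => if v ∈ B then 2 else 1) (Sum.elim (fun _ => 2) (fun _ => 1)) r) := by
        rintro (u | u) (v | w | b) h
        · simp only [cross6] at h
          simp only [Sum.elim_inl]
          by_cases h1 : u ∈ A <;> by_cases h2 : v ∈ B <;> simp [h1, h2]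
          exact h (hE u h1 v h2)
        · exact h.elim
        · simp only [Sum.elim_inl, Sum.elim_inr]
          split_ifs <;> decide
        · simp only [Sum.elim_inl, Sum.elim_inr]
          split_ifs <;> decide
        · simp
        · simp
      intro x y h
      rw [G6, SimpleGraph.fromRel_adj] at h
      rcases h with ⟨-, ⟨l, r, rfl, rfl, h⟩ | ⟨l, r, rfl, rfl, h⟩⟩
      · exact key l r h
      · exact (key l r h).symm
    · have cA : (univ.filter fun u => u ∉ A).card = n - k := by
        rw [← Finset.compl_filter, Finset.card_compl]; simp [hA]
      have cB : (univ.filter fun u => u ∉ B).card = n - k := by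
        rw [← Finset.compl_filter, Finset.card_compl]; simp [hB]
      intro i
      rw [cardSplit6]
      simp only [Sum.elim_inl, Sum.elim_inr]
      fin_cases i
      · have e1 : ∀ u, ((if u ∈ A then 2 else 0 : Fin 3) = 0) ↔ u ∉ A := by
          intro u; split_ifs <;> simp_all
        have e2 : ∀ u, ((if u ∈ B then 2 else 1 : Fin 3) = 0) ↔ False := by
          intro u; split_ifs <;> simp_all
        simp [e1, e2, cA]
      · have e1 : ∀ u, ((if u ∈ A then 2 else 0 : Fin 3) = 1) ↔ False := by
          intro u; split_ifs <;> simp_all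
        have e2 : ∀ u, ((if u ∈ B then 2 else 1 : Fin 3) = 1) ↔ u ∉ B := by
          intro u; split_ifs <;> simp_all
        simp [e1, e2, cB]
      · have e1 : ∀ u, ((if u ∈ A then 2 else 0 : Fin 3) = 2) ↔ u ∈ A := by
          intro u; split_ifs <;> simp_all
        have e2 : ∀ u, ((if u ∈ B then 2 else 1 : Fin 3) = 2) ↔ u ∈ B := by
          intro u; split_ifs <;> simp_all
        simp [e1, e2, hA, hB]
        omega
  · rintro ⟨φ, hφ, hc⟩
    have key : ∀ l r, cross6 n k E l r → φ (Sum.inl l) ≠ φ (Sum.inr r) := by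
      intro l r h
      apply hφ
      rw [G6, SimpleGraph.fromRel_adj]
      exact ⟨by simp, Or.inl ⟨l, r, rfl, rfl, h⟩⟩
    obtain ⟨γ, hγa, hγb, hall⟩ := third6 _ _ (key (Sum.inr ()) (Sum.inr (Sum.inr ())) trivial)
    have hα := hc (φ (Sum.inl (Sum.inr ())))
    have hγ := hc γ
    rw [cardSplit6] at hα hγ
    have ha : ∀ r, φ (Sum.inr r) ≠ φ (Sum.inl (Sum.inr ())) :=
      fun r => (key (Sum.inr ()) r (by simp [cross6])).symm
    have hb : ∀ u, φ (Sum.inl (Sum.inl u)) ≠ φ (Sum.inr (Sum.inr (Sum.inr ()))) :=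
      fun u => key (Sum.inl u) _ trivial
    simp only [ha, if_true, if_false, Finset.filter_false, Finset.card_empty] at hα
    simp only [hγa.symm, hγb.symm, if_false] at hγ
    have hV : (univ.filter fun u => φ (Sum.inl (Sum.inl u)) = φ (Sum.inl (Sum.inr ()))).card
        + (univ.filter fun u => φ (Sum.inl (Sum.inl u)) = γ).card = n := by
      have h1 : (univ.filter fun u => φ (Sum.inl (Sum.inl u)) = γ)
          = univ.filter fun u => ¬ φ (Sum.inl (Sum.inl u)) = φ (Sum.inl (Sum.inr ())) := by
        ext u
        simp only [Finset.mem_filter, Finset.mem_univ, true_and]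
        constructor
        · intro h; rw [h]; exact hγa
        · intro h
          rcases hall (φ (Sum.inl (Sum.inl u))) with h' | h' | h'
          · exact (h h').elim
          · exact (hb u h').elim
          · exact h'
      rw [h1, Finset.card_filter_add_card_filter_not]
      simp
    have hW : (univ.filter fun w => φ (Sum.inr (Sum.inr (Sum.inl w))) = γ).card
        ≤ n + 1 - 3 * k := by
      refine (Finset.card_le_univ _).trans ?_
      simp
    obtain ⟨A, hAs, hA⟩ := Finset.exists_subset_card_eq
      (s := univ.filter fun u => φ (Sum.inl (Sum.inl u)) = γ) (n := k) (by omega)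
    obtain ⟨B, hBs, hB⟩ := Finset.exists_subset_card_eq
      (s := univ.filter fun u => φ (Sum.inr (Sum.inl u)) = γ) (n := k) (by omega)
    refine ⟨A, B, hA, hB, fun a haA b hbB => ?_⟩
    by_contra hne
    have h1 := (Finset.mem_filter.1 (hAs haA)).2
    have h2 := (Finset.mem_filter.1 (hBs hbB)).2
    exact key (Sum.inl a) (Sum.inl b) hne (h1.trans h2.symm)
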